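/- Let S be a finite collection of m-element subsets of a finite set U, and assign a variable x_u to each u ∈ U. Define the polynomial F(S,k) = (Σ_{A ∈ S} ∏_{u ∈ A} x_u)^k. Then S contains k pairwise disjoint members if and only if the sum-product expansion of F(S,k) contains a multilinear monomial of degree mk. -/

import Mathlib

theorem prod_X_eq_monomial_indicator {U : Type*} (A : Finset U) :
    (∏ u ∈ A, MvPolynomial.X u : MvPolynomial U ℚ) =
      MvPolynomial.monomial (∑ u ∈ A, Finsupp.single u 1) 1 := by
  rw [MvPolynomial.monomial_sum_one]
  rfl

theorem sum_single_one_apply {U : Type*} [DecidableEq U] (A : Finset U) (v : U) :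
    (∑ u ∈ A, Finsupp.single u 1 : U →₀ ℕ) v = if v ∈ A then 1 else 0 := by
  simp [Finsupp.finsetSum_apply, Finsupp.single_apply]

theorem degree_sum_single_one {U : Type*} (A : Finset U) :
    (∑ u ∈ A, Finsupp.single u 1 : U →₀ ℕ).degree = A.card := by
  simp [map_sum]

theorem mem_support_sum_prod_X_pow {U : Type*} [DecidableEq U] (S : Finset (Finset U)) (k : ℕ)
    (d : U →₀ ℕ) :
    d ∈ ((∑ A ∈ S, ∏ u ∈ A, MvPolynomial.X u : MvPolynomial U ℚ) ^ k).support ↔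
      ∃ p : Fin k → Finset U, (∀ i, p i ∈ S) ∧ ∑ i, ∑ u ∈ p i, Finsupp.single u 1 = d := by
  have hprod (p : Fin k → Finset U) :
      (∏ i, MvPolynomial.monomial (∑ u ∈ p i, Finsupp.single u 1) 1 : MvPolynomial U ℚ) =
        MvPolynomial.monomial (∑ i, ∑ u ∈ p i, Finsupp.single u 1) 1 :=
    (MvPolynomial.monomial_sum_one _ _).symm
  have hpow := Finset.prod_univ_sum (ι := Fin k) (fun _ => S)
    (fun _ A => (MvPolynomial.monomial (∑ u ∈ A, Finsupp.single u 1) 1 : MvPolynomial U ℚ))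
  rw [Finset.prod_const, Finset.card_univ, Fintype.card_fin] at hpow
  simp only [prod_X_eq_monomial_indicator, MvPolynomial.mem_support_iff]
  rw [hpow]
  simp only [hprod, MvPolynomial.coeff_sum, MvPolynomial.coeff_monomial, Finset.sum_boole, ne_eq,
    Nat.cast_eq_zero, Finset.card_eq_zero, ← Finset.nonempty_iff_ne_empty]
  simp [Finset.Nonempty]

theorem sum_single_one_le_one_iff {U ι : Type*} [DecidableEq U] [Fintype ι]
    (p : ι → Finset U) :
    (∀ v, (∑ i, ∑ u ∈ p i, Finsupp.single u 1 : U →₀ ℕ) v ≤ 1) ↔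
      ∀ i j, i ≠ j → Disjoint (p i) (p j) := by
  have happly (v : U) : (∑ i, ∑ u ∈ p i, Finsupp.single u 1 : U →₀ ℕ) v =
      (Finset.univ.filter fun i => v ∈ p i).card := by
    rw [Finsupp.finsetSum_apply]
    simp only [sum_single_one_apply, Finset.sum_boole, Nat.cast_id]
  simp only [happly, Finset.card_le_one, Finset.mem_filter, Finset.mem_univ, true_and,
    Finset.disjoint_left]
  grind

theorem stmt_10 (U : Type*) [Fintype U] [DecidableEq U] (m k : ℕ) (hm : 1 ≤ m)
    (S : Finset (Finset U)) (hS : ∀ A ∈ S, A.card = m) :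
    (∃ P ⊆ S, P.card = k ∧ ∀ A ∈ P, ∀ B ∈ P, A ≠ B → Disjoint A B) ↔
    ∃ d ∈ ((∑ A ∈ S, ∏ u ∈ A, MvPolynomial.X u : MvPolynomial U ℚ) ^ k).support,
      (∀ u : U, d u ≤ 1) ∧ (d.sum fun _ e => e) = m * k := by
  constructor
  · rintro ⟨P, hPS, hPk, hP⟩
    let e := (P.equivFinOfCardEq hPk).symm
    refine ⟨∑ i, ∑ u ∈ (e i : Finset U), Finsupp.single u 1,
      (mem_support_sum_prod_X_pow S k _).2 ⟨fun i => e i, fun i => hPS (e i).2, rfl⟩, ?_, ?_⟩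
    · refine (sum_single_one_le_one_iff fun i => (e i : Finset U)).2 fun i j hij => ?_
      exact hP _ (e i).2 _ (e j).2 fun h => hij (e.injective (Subtype.ext h))
    · change Finsupp.degree _ = _
      rw [map_sum, Finset.sum_congr rfl fun i _ =>
        (degree_sum_single_one _).trans (hS _ (hPS (e i).2))]
      simp [mul_comm]
  · rintro ⟨d, hd, hd1, -⟩
    obtain ⟨p, hpS, rfl⟩ := (mem_support_sum_prod_X_pow S k d).1 hd
    have hdisj := (sum_single_one_le_one_iff p).1 hd1
    have hinj : Function.Injective p := by
      intro i j hij
      by_contra hne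
      have h := hdisj i j hne
      rw [← hij, disjoint_self, Finset.bot_eq_empty] at h
      have hcard := hS _ (hpS i)
      rw [h, Finset.card_empty] at hcard
      omega
    refine ⟨Finset.univ.image p, ?_, ?_, ?_⟩
    · simpa [Finset.image_subset_iff] using hpS
    · simp [Finset.card_image_of_injective _ hinj]
    · simp only [Finset.mem_image, Finset.mem_univ, true_and]
      rintro _ ⟨i, rfl⟩ _ ⟨j, rfl⟩ hij
      exact hdisj i j fun h => hij (congrArg p h)
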